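/- Let θ₁₂, θ₁₃ ∈ [0, π/2) with cos θ₁₃ ≠ 0, suppose sin²θ₁₂ = 1 − 2/(3·cos²θ₁₃) (the TM₁ solar sum rule), and let θ₂₃ satisfy sin²θ₂₃ = 1/2. Then 1/6 − sin²θ₁₂ cos²θ₂₃ − cos²θ₁₂ sin²θ₂₃ sin²θ₁₃ = 0; consequently, in the TM₁ atmospheric sum rule cos δ = (1/6 − sin²θ₁₂ cos²θ₂₃ − cos²θ₁₂ sin²θ₂₃ sin²θ₁₃)/(2 sinθ₁₂ cosθ₁₂ sinθ₂₃ cosθ₂₃ sinθ₁₃), maximal atmospheric mixing implies cos δ = 0. -/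

import Mathlib

open Real

/-- **Maximal atmospheric mixing implies maximal CP violation in TM₁.** If
`θ₁₂, θ₁₃ ∈ [0, π/2)` with `cos θ₁₃ ≠ 0` satisfy the TM₁ solar sum rule
`sin²θ₁₂ = 1 − 2/(3·cos²θ₁₃)`, and `θ₂₃` satisfies `sin²θ₂₃ = 1/2`, then the numerator
of the TM₁ atmospheric sum rule vanishes,
`1/6 − sin²θ₁₂ cos²θ₂₃ − cos²θ₁₂ sin²θ₂₃ sin²θ₁₃ = 0`, and consequently
`cos δ = (1/6 − sin²θ₁₂ cos²θ₂₃ − cos²θ₁₂ sin²θ₂₃ sin²θ₁₃)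
         /(2 sinθ₁₂ cosθ₁₂ sinθ₂₃ cosθ₂₃ sinθ₁₃) = 0`. -/
theorem TM1_maximal_mixing_maximal_CP (θ₁₂ θ₂₃ θ₁₃ : ℝ)
    (h₁₂ : θ₁₂ ∈ Set.Ico 0 (π / 2)) (h₁₃ : θ₁₃ ∈ Set.Ico 0 (π / 2))
    (hcos : cos θ₁₃ ≠ 0)
    (hsolar : sin θ₁₂ ^ 2 = 1 - 2 / (3 * cos θ₁₃ ^ 2))
    (hatm : sin θ₂₃ ^ 2 = 1 / 2) :
    1 / 6 - sin θ₁₂ ^ 2 * cos θ₂₃ ^ 2 -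
        cos θ₁₂ ^ 2 * sin θ₂₃ ^ 2 * sin θ₁₃ ^ 2 = 0 ∧
    (1 / 6 - sin θ₁₂ ^ 2 * cos θ₂₃ ^ 2 -
        cos θ₁₂ ^ 2 * sin θ₂₃ ^ 2 * sin θ₁₃ ^ 2) /
      (2 * sin θ₁₂ * cos θ₁₂ * sin θ₂₃ * cos θ₂₃ * sin θ₁₃) = 0 := by
  have numerator_eq_zero : 1 / 6 - sin θ₁₂ ^ 2 * cos θ₂₃ ^ 2 -
      cos θ₁₂ ^ 2 * sin θ₂₃ ^ 2 * sin θ₁₃ ^ 2 = 0 := by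
    rw [cos_sq' θ₂₃, cos_sq' θ₁₂, hatm, hsolar, sin_sq θ₁₃]
    field_simp
    ring
  exact ⟨numerator_eq_zero, by rw [numerator_eq_zero, zero_div]⟩
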